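/- arXiv:1103.1784 — 5 statements merged into one kernel-verified Lean document; each statement's English description precedes it below -/
import Mathlib

section
/- Fix real numbers p01, p11 with 0 ≤ p01 ≤ p11 ≤ 1, an integer N ≥ 3, and a belief vector ω = (ω1, …, ωN) with 1 ≥ ω1 ≥ ω2 ≥ ⋯ ≥ ωN ≥ 0. Then for every two-slot sense-two policy (i.e., every choice of a first-slot pair {a,b} of distinct channel indices and of observation-dependent second-slot pairs {c_s,d_s}), the expected two-slot reward V of that policy satisfies V ≤ R*, where R* = [1 − (1−ω1)(1−ω2)] + ω1ω2[1 − (1−p11)²] + ω1(1−ω2)[1 − (1−p11)(1−τ(ω3))] + (1−ω1)ω2[1 − (1−p11)(1−τ(ω3))] + (1−ω1)(1−ω2)[1 − (1−τ(ω3))(1−F)], with F = τ(ω4) if N ≥ 4 and F = p01 if N = 3. (R* is the expected two-slot reward of the myopic policy that senses the two channels with the largest beliefs in each slot; hence the myopic sensing policy is optimal for T = 2, k = 2 when p11 ≥ p01.) -/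
/-- Belief update operator `τ(ω) = ω·p11 + (1−ω)·p01`. -/
noncomputable def tau (p01 p11 w : ℝ) : ℝ := w * p11 + (1 - w) * p01

/-- Updated belief after sensing channels `a`,`b` with observation outcome
`s : Bool × Bool` (`true` = idle, `false` = busy). -/
noncomputable def nu (p01 p11 : ℝ) {N : ℕ} (ω : Fin N → ℝ) (a b : Fin N)
    (s : Bool × Bool) (i : Fin N) : ℝ :=
  if i = a then (if s.1 then p11 else p01)
  else if i = b then (if s.2 then p11 else p01)
  else tau p01 p11 (ω i)

/-- Probability of observation outcome `s` when sensing channels `a`,`b`. -/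
noncomputable def outcomeProb {N : ℕ} (ω : Fin N → ℝ) (a b : Fin N)
    (s : Bool × Bool) : ℝ :=
  (if s.1 then ω a else 1 - ω a) * (if s.2 then ω b else 1 - ω b)

/-- Expected two-slot reward of the policy sensing `{a,b}` in the first slot and,
after outcome `s`, the pair `{c s, d s}` in the second slot. -/
noncomputable def policyReward (p01 p11 : ℝ) {N : ℕ} (ω : Fin N → ℝ) (a b : Fin N)
    (c d : (Bool × Bool) → Fin N) : ℝ :=
  (1 - (1 - ω a) * (1 - ω b)) +
    ∑ s : Bool × Bool,
      outcomeProb ω a b s *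
        (1 - (1 - nu p01 p11 ω a b s (c s)) * (1 - nu p01 p11 ω a b s (d s)))

/-- Expected two-slot reward when channels with beliefs `x`, `y` are sensed first and the best
two of the remaining channels have beliefs `u ≥ v`. -/
noncomputable def greedyReward (p01 p11 x y u v : ℝ) : ℝ :=
  (1 - (1 - x) * (1 - y))
  + x * y * (1 - (1 - p11) * (1 - p11))
  + x * (1 - y) * (1 - (1 - p11) * (1 - tau p01 p11 u))
  + (1 - x) * y * (1 - (1 - p11) * (1 - tau p01 p11 u))
  + (1 - x) * (1 - y) * (1 - (1 - tau p01 p11 u) * (1 - tau p01 p11 v))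

theorem greedyReward_comm (p01 p11 x y u v : ℝ) :
    greedyReward p01 p11 x y u v = greedyReward p01 p11 y x u v := by
  unfold greedyReward; ring

section tau

variable {p01 p11 : ℝ}

theorem tau_mono (hp : p01 ≤ p11) {x y : ℝ} (h : x ≤ y) : tau p01 p11 x ≤ tau p01 p11 y := by
  unfold tau; nlinarith [mul_nonneg (sub_nonneg.2 hp) (sub_nonneg.2 h)]

theorem tau_le (hp : p01 ≤ p11) {x : ℝ} (h : x ≤ 1) : tau p01 p11 x ≤ p11 := by
  unfold tau; nlinarith [mul_nonneg (sub_nonneg.2 hp) (sub_nonneg.2 h)]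

theorem le_tau (hp : p01 ≤ p11) {x : ℝ} (h : 0 ≤ x) : p01 ≤ tau p01 p11 x := by
  unfold tau; nlinarith [mul_nonneg (sub_nonneg.2 hp) h]

end tau

theorem pair_reward_le {x y A B : ℝ} (hA : A ≤ 1) (hB : B ≤ 1)
    (h : x ≤ A ∧ y ≤ B ∨ x ≤ B ∧ y ≤ A) :
    1 - (1 - x) * (1 - y) ≤ 1 - (1 - A) * (1 - B) := by
  rcases h with ⟨h1, h2⟩ | ⟨h1, h2⟩
  · have := mul_le_mul (sub_le_sub_left h1 1) (sub_le_sub_left h2 1) (by linarith) (by linarith)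
    linarith
  · have := mul_le_mul (sub_le_sub_left h1 1) (sub_le_sub_left h2 1) (by linarith) (by linarith)
    linarith

section exchange

variable {p01 p11 x y u v : ℝ}

/-- Sensing first a channel better than `y` instead of `y`, then having `y` as best remaining
channel, is an improvement. -/
theorem greedyReward_swap_fst (hp0 : 0 ≤ p01) (hp1 : p01 ≤ p11) (hp2 : p11 ≤ 1) (hx : x ≤ 1)
    (hv0 : 0 ≤ v) (hv : v ≤ 1) (h : y ≤ u) :
    greedyReward p01 p11 x y u v ≤ greedyReward p01 p11 x u y v := by
  have hq : (1 - p11) * (p11 - p01) ≤ 1 :=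
    mul_le_one₀ (by linarith) (by linarith) (by linarith)
  have hqv : (1 - p11) * (p11 - p01) * v ≤ 1 := mul_le_one₀ hq hv0 hv
  have key : 0 ≤ (1 - x) * (u - y) * (1 - (1 - p11) * (p11 - p01) * v) :=
    mul_nonneg (mul_nonneg (by linarith) (by linarith)) (by linarith)
  have : greedyReward p01 p11 x u y v - greedyReward p01 p11 x y u v
      = (1 - x) * (u - y) * (1 - (1 - p11) * (p11 - p01) * v) := by
    unfold greedyReward tau; ring
  linarith

theorem greedyReward_swap_snd (hp1 : p01 ≤ p11) (hp2 : p11 ≤ 1) (hx0 : 0 ≤ x) (hx : x ≤ 1)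
    (hu : u ≤ 1) (h : y ≤ v) :
    greedyReward p01 p11 x y u v ≤ greedyReward p01 p11 x v u y := by
  have key : 0 ≤ (v - y) * ((1 - x) + (1 - p11) * (p11 - p01) * ((1 - u) * x)) :=
    mul_nonneg (by linarith) (add_nonneg (by linarith)
      (mul_nonneg (mul_nonneg (by linarith) (by linarith)) (mul_nonneg (by linarith) hx0)))
  have : greedyReward p01 p11 x v u y - greedyReward p01 p11 x y u v
      = (v - y) * ((1 - x) + (1 - p11) * (p11 - p01) * ((1 - u) * x)) := by
    unfold greedyReward tau; ring
  linarith

theorem greedyReward_mono_right (hp1 : p01 ≤ p11) (hp2 : p11 ≤ 1) (hx0 : 0 ≤ x) (hx : x ≤ 1)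
    (hu : u ≤ 1) (hv : v ≤ 1) {y' : ℝ} (h : y ≤ y') :
    greedyReward p01 p11 x y u v ≤ greedyReward p01 p11 x y' u v := by
  have hq : 0 ≤ (1 - p11) * (p11 - p01) := mul_nonneg (by linarith) (by linarith)
  have hU : 0 ≤ 1 - u := by linarith
  have hV : 0 ≤ 1 - v := by linarith
  have hX : 0 ≤ 1 - x := by linarith
  have h' : 0 ≤ y' - y := by linarith
  have key : 0 ≤ (y' - y) * ((1 - x)
      + (1 - p11) * (p11 - p01) * ((1 - u) * x + (1 - x) * (1 - v))
      + (p11 - p01) ^ 2 * ((1 - x) * ((1 - u) * (1 - v)))) := by positivity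
  have : greedyReward p01 p11 x y' u v - greedyReward p01 p11 x y u v
      = (y' - y) * ((1 - x)
      + (1 - p11) * (p11 - p01) * ((1 - u) * x + (1 - x) * (1 - v))
      + (p11 - p01) ^ 2 * ((1 - x) * ((1 - u) * (1 - v)))) := by
    unfold greedyReward tau; ring
  linarith

end exchange

/-- Whatever two entries `a ≠ b` of a decreasing sequence of beliefs are removed, the best two
remaining beliefs `u ≥ v` give a greedy reward at most the one of the sorted order. -/
theorem exists_best_remaining {p01 p11 : ℝ} (hp0 : 0 ≤ p01) (hp1 : p01 ≤ p11) (hp2 : p11 ≤ 1)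
    {e : ℕ → ℝ} (he : Antitone e) (h0 : ∀ i, 0 ≤ e i) (h1 : ∀ i, e i ≤ 1) {a b : ℕ}
    (hab : a ≠ b) :
    ∃ u v : ℝ, 0 ≤ v ∧ v ≤ u ∧ u ≤ 1 ∧ (∀ i, i ≠ a → i ≠ b → e i ≤ u) ∧
      (∀ i j, i ≠ j → i ≠ a → i ≠ b → j ≠ a → j ≠ b → e i ≤ v ∨ e j ≤ v) ∧
      greedyReward p01 p11 (e a) (e b) u v ≤ greedyReward p01 p11 (e 0) (e 1) (e 2) (e 3) := by
  wlog hlt : a < b generalizing a b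
  · obtain ⟨u, v, hv, hvu, hu, hi, hij, hW⟩ := this hab.symm (by omega)
    refine ⟨u, v, hv, hvu, hu, fun i ha hb => hi i hb ha,
      fun i j hne h1 h2 h3 h4 => hij i j hne h2 h1 h4 h3, ?_⟩
    rwa [greedyReward_comm]
  suffices ∃ k l : ℕ, k < l ∧ (∀ i, i ≠ a → i ≠ b → k ≤ i) ∧
      (∀ i j, i ≠ j → i ≠ a → i ≠ b → j ≠ a → j ≠ b → l ≤ i ∨ l ≤ j) ∧
      greedyReward p01 p11 (e a) (e b) (e k) (e l) ≤
        greedyReward p01 p11 (e 0) (e 1) (e 2) (e 3) by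
    obtain ⟨k, l, hkl, hi, hij, hW⟩ := this
    exact ⟨e k, e l, h0 l, he hkl.le, h1 k, fun i ha hb => he (hi i ha hb),
      fun i j hne ha hb ha' hb' => (hij i j hne ha hb ha' hb').imp (he ·) (he ·), hW⟩
  have swap_fst : ∀ {x y u v : ℕ}, u ≤ y → greedyReward p01 p11 (e x) (e y) (e u) (e v) ≤
      greedyReward p01 p11 (e x) (e u) (e y) (e v) := fun h =>
    greedyReward_swap_fst hp0 hp1 hp2 (h1 _) (h0 _) (h1 _) (he h)
  have swap_snd : ∀ {x y u v : ℕ}, v ≤ y → greedyReward p01 p11 (e x) (e y) (e u) (e v) ≤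
      greedyReward p01 p11 (e x) (e v) (e u) (e y) := fun h =>
    greedyReward_swap_snd hp1 hp2 (h0 _) (h1 _) (h1 _) (he h)
  have mono : ∀ {x y y' u v : ℕ}, y' ≤ y → greedyReward p01 p11 (e x) (e y) (e u) (e v) ≤
      greedyReward p01 p11 (e x) (e y') (e u) (e v) := fun h =>
    greedyReward_mono_right hp1 hp2 (h0 _) (h1 _) (h1 _) (h1 _) (he h)
  have pair13 : greedyReward p01 p11 (e 0) (e 2) (e 1) (e 3) ≤
      greedyReward p01 p11 (e 0) (e 1) (e 2) (e 3) := swap_fst (by omega)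
  have pair14 : greedyReward p01 p11 (e 0) (e 3) (e 1) (e 2) ≤
      greedyReward p01 p11 (e 0) (e 1) (e 2) (e 3) := (swap_snd (by omega)).trans pair13
  have pair23 : greedyReward p01 p11 (e 1) (e 2) (e 0) (e 3) ≤
      greedyReward p01 p11 (e 0) (e 1) (e 2) (e 3) := by
    refine (swap_fst (by omega)).trans_eq ?_
    rw [greedyReward_comm]
  have pair24 : greedyReward p01 p11 (e 1) (e 3) (e 0) (e 2) ≤
      greedyReward p01 p11 (e 0) (e 1) (e 2) (e 3) := (swap_snd (by omega)).trans pair23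
  have pair34 : greedyReward p01 p11 (e 2) (e 3) (e 0) (e 1) ≤
      greedyReward p01 p11 (e 0) (e 1) (e 2) (e 3) := by
    refine (swap_snd (by omega)).trans ?_
    rw [greedyReward_comm]
    exact pair23
  by_cases ha0 : a = 0
  · subst ha0
    by_cases hb1 : b = 1
    · subst hb1
      exact ⟨2, 3, by omega, by omega, by omega, le_rfl⟩
    by_cases hb2 : b = 2
    · subst hb2
      exact ⟨1, 3, by omega, by omega, by omega, pair13⟩
    exact ⟨1, 2, by omega, by omega, by omega, (mono (by omega)).trans pair14⟩
  by_cases ha1 : a = 1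
  · subst ha1
    by_cases hb2 : b = 2
    · subst hb2
      exact ⟨0, 3, by omega, by omega, by omega, pair23⟩
    exact ⟨0, 2, by omega, by omega, by omega, (mono (by omega)).trans pair24⟩
  refine ⟨0, 1, by omega, by omega, by omega, (mono (y' := 3) (by omega)).trans ?_⟩
  rw [greedyReward_comm]
  refine (mono (y' := 2) (by omega)).trans ?_
  rw [greedyReward_comm]
  exact pair34

/-- Given the first-slot pair, no second-slot choice beats sensing the channels with the largest
updated beliefs. -/
theorem policyReward_le_greedyReward {p01 p11 : ℝ} (hp1 : p01 ≤ p11) (hp2 : p11 ≤ 1) {N : ℕ}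
    {ω : Fin N → ℝ} (h0 : ∀ i, 0 ≤ ω i) (h1 : ∀ i, ω i ≤ 1) {a b : Fin N}
    {c d : (Bool × Bool) → Fin N} (hcd : ∀ s, c s ≠ d s) {u v : ℝ} (hv : 0 ≤ v) (hvu : v ≤ u)
    (hu : u ≤ 1) (hi : ∀ i, i ≠ a → i ≠ b → ω i ≤ u)
    (hij : ∀ i j, i ≠ j → i ≠ a → i ≠ b → j ≠ a → j ≠ b → ω i ≤ v ∨ ω j ≤ v) :
    policyReward p01 p11 ω a b c d ≤ greedyReward p01 p11 (ω a) (ω b) u v := by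
  have hv1 := le_tau hp1 hv
  have hvu' := tau_mono hp1 hvu
  have hu' := tau_le hp1 hu
  have le_p11 : ∀ s i, nu p01 p11 ω a b s i ≤ p11 := by
    intro s i
    have := tau_le hp1 (h1 i)
    unfold nu
    split_ifs <;> linarith
  have le_tau_u : ∀ s i, (i = a → s.1 = false) → (i = b → s.2 = false) →
      nu p01 p11 ω a b s i ≤ tau p01 p11 u := by
    intro s i ha hb
    unfold nu
    split_ifs with k1 k2 k3 k4
    · simp_all
    · linarith
    · simp_all
    · linarith
    · exact tau_mono hp1 (hi i k1 k3)
  have le_tau_v : ∀ i j, i ≠ j → nu p01 p11 ω a b (false, false) i ≤ tau p01 p11 v ∨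
      nu p01 p11 ω a b (false, false) j ≤ tau p01 p11 v := by
    intro i j hne
    by_cases ia : i = a
    · left; simp [nu, ia, hv1]
    by_cases ib : i = b
    · left; simp [nu, ib, hv1]
    by_cases ja : j = a
    · right; simp [nu, ja, hv1]
    by_cases jb : j = b
    · right; simp [nu, jb, hv1]
    simp only [nu, ia, ib, ja, jb, if_false]
    exact (hij i j hne ia ib ja jb).imp (tau_mono hp1) (tau_mono hp1)
  have hTT := pair_reward_le hp2 hp2
    (.inl ⟨le_p11 (true, true) (c (true, true)), le_p11 (true, true) (d (true, true))⟩)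
  have hTF := pair_reward_le (x := nu p01 p11 ω a b (true, false) (c (true, false)))
    (y := nu p01 p11 ω a b (true, false) (d (true, false))) hp2 (hu'.trans hp2) <| by
    by_cases hc : c (true, false) = a
    · exact .inl ⟨le_p11 _ _, le_tau_u _ _ (fun h => absurd (hc.trans h.symm) (hcd _))
        (fun _ => rfl)⟩
    · exact .inr ⟨le_tau_u _ _ (fun h => absurd h hc) (fun _ => rfl), le_p11 _ _⟩
  have hFT := pair_reward_le (x := nu p01 p11 ω a b (false, true) (c (false, true)))
    (y := nu p01 p11 ω a b (false, true) (d (false, true))) hp2 (hu'.trans hp2) <| by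
    by_cases hc : c (false, true) = b
    · exact .inl ⟨le_p11 _ _, le_tau_u _ _ (fun _ => rfl)
        (fun h => absurd (hc.trans h.symm) (hcd _))⟩
    · exact .inr ⟨le_tau_u _ _ (fun _ => rfl) (fun h => absurd h hc), le_p11 _ _⟩
  have hFF := pair_reward_le (x := nu p01 p11 ω a b (false, false) (c (false, false)))
    (y := nu p01 p11 ω a b (false, false) (d (false, false))) (hu'.trans hp2)
    ((hvu'.trans hu').trans hp2) <| by
    have hall := fun i => le_tau_u (false, false) i (fun _ => rfl) (fun _ => rfl)
    rcases le_tau_v _ _ (hcd (false, false)) with h | h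
    · exact .inr ⟨h, hall _⟩
    · exact .inl ⟨hall _, h⟩
  have ha : 0 ≤ 1 - ω a := sub_nonneg.2 (h1 a)
  have hb : 0 ≤ 1 - ω b := sub_nonneg.2 (h1 b)
  have kTT := mul_le_mul_of_nonneg_left hTT (mul_nonneg (h0 a) (h0 b))
  have kTF := mul_le_mul_of_nonneg_left hTF (mul_nonneg (h0 a) hb)
  have kFT := mul_le_mul_of_nonneg_left hFT (mul_nonneg ha (h0 b))
  have kFF := mul_le_mul_of_nonneg_left hFF (mul_nonneg ha hb)
  simp only [policyReward, greedyReward, outcomeProb, Fintype.sum_prod_type, Fintype.sum_bool,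
    if_true, Bool.false_eq_true, if_false]
  linarith

/-- Optimality of the myopic sensing policy for `T = 2`, `k = 2` when `p11 ≥ p01`:
every two-slot sense-two policy earns at most the myopic reward `R*`. -/
theorem myopic_optimal_T2_k2_pos (p01 p11 : ℝ)
    (hp0 : 0 ≤ p01) (hp1 : p01 ≤ p11) (hp2 : p11 ≤ 1)
    (N : ℕ) (hN : 3 ≤ N) (ω : Fin N → ℝ)
    (hub : ω ⟨0, by omega⟩ ≤ 1) (hlb : 0 ≤ ω ⟨N - 1, by omega⟩)
    (hmono : ∀ i j : Fin N, i ≤ j → ω j ≤ ω i)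
    (a b : Fin N) (hab : a ≠ b)
    (c d : (Bool × Bool) → Fin N) (hcd : ∀ s, c s ≠ d s) :
    policyReward p01 p11 ω a b c d ≤
      (1 - (1 - ω ⟨0, by omega⟩) * (1 - ω ⟨1, by omega⟩))
      + ω ⟨0, by omega⟩ * ω ⟨1, by omega⟩ * (1 - (1 - p11) * (1 - p11))
      + ω ⟨0, by omega⟩ * (1 - ω ⟨1, by omega⟩) *
          (1 - (1 - p11) * (1 - tau p01 p11 (ω ⟨2, by omega⟩)))
      + (1 - ω ⟨0, by omega⟩) * ω ⟨1, by omega⟩ *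
          (1 - (1 - p11) * (1 - tau p01 p11 (ω ⟨2, by omega⟩)))
      + (1 - ω ⟨0, by omega⟩) * (1 - ω ⟨1, by omega⟩) *
          (1 - (1 - tau p01 p11 (ω ⟨2, by omega⟩)) *
            (1 - if h : 4 ≤ N then tau p01 p11 (ω ⟨3, h⟩) else p01)) := by
  have h0 : ∀ i, 0 ≤ ω i := fun i => hlb.trans (hmono _ _ (Fin.le_def.2 (by simp; omega)))
  have h1 : ∀ i, ω i ≤ 1 := fun i => (hmono _ _ (Fin.le_def.2 (by simp))).trans hub
  let e : ℕ → ℝ := fun i => if h : i < N then ω ⟨i, h⟩ else 0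
  have e_lt : ∀ {i : ℕ} (h : i < N), e i = ω ⟨i, h⟩ := fun h => dif_pos h
  have e_val : ∀ i : Fin N, e i = ω i := fun i => e_lt i.2
  have e0 : ∀ i, 0 ≤ e i := by
    intro i
    by_cases h : i < N
    · rw [e_lt h]; exact h0 _
    · simp [e, h]
  have e1 : ∀ i, e i ≤ 1 := by
    intro i
    by_cases h : i < N
    · rw [e_lt h]; exact h1 _
    · simp [e, h]
  have he : Antitone e := by
    intro i j hij
    by_cases h : j < N
    · rw [e_lt h, e_lt (hij.trans_lt h)]
      exact hmono _ _ hij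
    · simpa [e, h] using e0 i
  obtain ⟨u, v, hv, hvu, hu, hi, hij, hW⟩ :=
    exists_best_remaining hp0 hp1 hp2 he e0 e1 (fun h => hab (Fin.ext h))
  have hF : (if h : 4 ≤ N then tau p01 p11 (ω ⟨3, h⟩) else p01) = tau p01 p11 (e 3) := by
    by_cases h : 4 ≤ N
    · rw [dif_pos h, e_lt h]
    · have h' : ¬ 3 < N := h
      simp [e, h, h', tau]
  rw [hF, ← e_lt (i := 0), ← e_lt (i := 1), ← e_lt (i := 2)]
  rw [e_val, e_val] at hW
  refine (policyReward_le_greedyReward hp1 hp2 h0 h1 hcd hv hvu hu ?_ ?_).trans hW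
  · intro i ha hb
    rw [← e_val]
    exact hi _ (fun h => ha (Fin.ext h)) (fun h => hb (Fin.ext h))
  · intro i j hne ha hb ha' hb'
    rw [← e_val, ← e_val]
    exact hij _ _ (fun h => hne (Fin.ext h)) (fun h => ha (Fin.ext h)) (fun h => hb (Fin.ext h))
      (fun h => ha' (Fin.ext h)) (fun h => hb' (Fin.ext h))
end

section
/- Fix real numbers p01, p11 with 0 ≤ p01 ≤ p11 ≤ 1 and real numbers ω1, ω2, ω3, ω4 ∈ [0,1] with ω1 ≥ ω2 ≥ ω3 ≥ ω4. Let F = τ(ω4) (or F = p01 when only three channels exist). Then R* ≥ R̄1, where R* = [1 − (1−ω1)(1−ω2)] + ω1ω2[1 − (1−p11)²] + ω1(1−ω2)[1 − (1−p11)(1−τ(ω3))] + (1−ω1)ω2[1 − (1−p11)(1−τ(ω3))] + (1−ω1)(1−ω2)[1 − (1−τ(ω3))(1−F)], and R̄1 = [1 − (1−ω1)(1−ω3)] + ω1ω3[1 − (1−p11)²] + ω1(1−ω3)[1 − (1−p11)(1−τ(ω2))] + (1−ω1)ω3[1 − (1−p11)(1−τ(ω2))] + (1−ω1)(1−ω3)[1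 − (1−τ(ω2))(1−p01)]. That is, when p11 ≥ p01, sensing channels {1,3} in the first slot cannot outperform the myopic choice {1,2}. -/
/-- When `p11 ≥ p01`, sensing channels `{1,3}` in the first slot cannot outperform
the myopic choice `{1,2}`: `R̄1 ≤ R*`. -/
theorem Rbar1_le_Rstar (p01 p11 ω1 ω2 ω3 ω4 F : ℝ)
    (hp0 : 0 ≤ p01) (hp1 : p01 ≤ p11) (hp2 : p11 ≤ 1)
    (h1 : 0 ≤ ω1) (h1' : ω1 ≤ 1) (h2 : 0 ≤ ω2) (h2' : ω2 ≤ 1)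
    (h3 : 0 ≤ ω3) (h3' : ω3 ≤ 1) (h4 : 0 ≤ ω4) (h4' : ω4 ≤ 1)
    (h12 : ω2 ≤ ω1) (h23 : ω3 ≤ ω2) (h34 : ω4 ≤ ω3)
    (hF : F = tau p01 p11 ω4 ∨ F = p01) :
    ((1 - (1 - ω1) * (1 - ω3))
      + ω1 * ω3 * (1 - (1 - p11) * (1 - p11))
      + ω1 * (1 - ω3) * (1 - (1 - p11) * (1 - tau p01 p11 ω2))
      + (1 - ω1) * ω3 * (1 - (1 - p11) * (1 - tau p01 p11 ω2))
      + (1 - ω1) * (1 - ω3) * (1 - (1 - tau p01 p11 ω2) * (1 - p01)))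
    ≤
    ((1 - (1 - ω1) * (1 - ω2))
      + ω1 * ω2 * (1 - (1 - p11) * (1 - p11))
      + ω1 * (1 - ω2) * (1 - (1 - p11) * (1 - tau p01 p11 ω3))
      + (1 - ω1) * ω2 * (1 - (1 - p11) * (1 - tau p01 p11 ω3))
      + (1 - ω1) * (1 - ω2) * (1 - (1 - tau p01 p11 ω3) * (1 - F))) := by
  have hd : 0 ≤ p11 - p01 := sub_nonneg.2 hp1
  have hFp : 0 ≤ F - p01 := by
    rcases hF with rfl | rfl
    · have := mul_nonneg h4 hd
      unfold tau
      linarith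
    · simp
  have hτ : 0 ≤ 1 - tau p01 p11 ω3 := by
    have := mul_nonneg h3 (sub_nonneg.2 hp2)
    have := mul_nonneg (sub_nonneg.2 h3') (sub_nonneg.2 (hp1.trans hp2))
    unfold tau
    linarith
  have gain : 0 ≤ (1 - ω1) * (ω2 - ω3) :=
    mul_nonneg (sub_nonneg.2 h1') (sub_nonneg.2 h23)
  have gain' : 0 ≤ (1 - ω1) * (1 - ω2) * (1 - tau p01 p11 ω3) * (F - p01) :=
    mul_nonneg (mul_nonneg (mul_nonneg (sub_nonneg.2 h1') (sub_nonneg.2 h2')) hτ) hFp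
  unfold tau at *
  linear_combination gain + gain'
end

section
/- Fix real numbers p01, p11 with 0 ≤ p01 ≤ p11 ≤ 1 and real numbers ω1, ω2, ω3, ω4, x ∈ [0,1] with ω1 ≥ ω2 ≥ ω3 ≥ ω4 ≥ x (here x plays the role of the belief ω_j of a channel j ≥ 4). Then R* ≥ R̄1(x), where R* = [1 − (1−ω1)(1−ω2)] + ω1ω2[1 − (1−p11)²] + ω1(1−ω2)[1 − (1−p11)(1−τ(ω3))] + (1−ω1)ω2[1 − (1−p11)(1−τ(ω3))] + (1−ω1)(1−ω2)[1 − (1−τ(ω3))(1−τ(ω4))], and R̄1(x) = [1 − (1−ω1)(1−x)] + ω1·x·[1 − (1−p11)²] + ω1(1−x)[1 − (1−p11)(1−τ(ω2))] + (1−ω1)·x·[1 − (1−p11)(1−τ(ω2))] + (1−ω1)(1−x)[1 − (1−τ(ω2))(1−τ(ω3))]. That is, when p11 ≥ p01, sensing channels {1,j} with j ≥ 4 in the first slot cannot outperform the myopic choice {1,2}. -/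
/-- When `p11 ≥ p01`, sensing channels `{1,j}` with `j ≥ 4` (belief `x ≤ ω4`)
in the first slot cannot outperform the myopic choice `{1,2}`: `R̄1(x) ≤ R*`. -/
theorem Rbar1x_le_Rstar (p01 p11 ω1 ω2 ω3 ω4 x : ℝ)
    (hp0 : 0 ≤ p01) (hp1 : p01 ≤ p11) (hp2 : p11 ≤ 1)
    (h1 : 0 ≤ ω1) (h1' : ω1 ≤ 1) (h2 : 0 ≤ ω2) (h2' : ω2 ≤ 1)
    (h3 : 0 ≤ ω3) (h3' : ω3 ≤ 1) (h4 : 0 ≤ ω4) (h4' : ω4 ≤ 1)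
    (hx : 0 ≤ x) (hx' : x ≤ 1)
    (h12 : ω2 ≤ ω1) (h23 : ω3 ≤ ω2) (h34 : ω4 ≤ ω3) (h4x : x ≤ ω4) :
    ((1 - (1 - ω1) * (1 - x))
      + ω1 * x * (1 - (1 - p11) * (1 - p11))
      + ω1 * (1 - x) * (1 - (1 - p11) * (1 - tau p01 p11 ω2))
      + (1 - ω1) * x * (1 - (1 - p11) * (1 - tau p01 p11 ω2))
      + (1 - ω1) * (1 - x) * (1 - (1 - tau p01 p11 ω2) * (1 - tau p01 p11 ω3)))
    ≤
    ((1 - (1 - ω1) * (1 - ω2))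
      + ω1 * ω2 * (1 - (1 - p11) * (1 - p11))
      + ω1 * (1 - ω2) * (1 - (1 - p11) * (1 - tau p01 p11 ω3))
      + (1 - ω1) * ω2 * (1 - (1 - p11) * (1 - tau p01 p11 ω3))
      + (1 - ω1) * (1 - ω2) * (1 - (1 - tau p01 p11 ω3) * (1 - tau p01 p11 ω4))) := by
  have hq : 0 ≤ 1 - p11 := by linarith
  have hd : 0 ≤ p11 - p01 := by linarith
  have hqd : (1 - p11) * (p11 - p01) ≤ 1 := mul_le_one₀ (by linarith) hd (by linarith)
  have hω : (ω2 - ω3) * x ≤ ω2 - x := by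
    linarith [mul_le_of_le_one_right (sub_nonneg.2 h23) hx']
  have hgain : (1 - p11) * (p11 - p01) * ((ω2 - ω3) * x) ≤ ω2 - x :=
    (mul_le_of_le_one_left (mul_nonneg (sub_nonneg.2 h23) hx) hqd).trans hω
  have hs : 0 ≤ 1 - tau p01 p11 ω3 := by
    have := mul_nonneg hd (sub_nonneg.2 h3')
    unfold tau
    linarith
  have hrest : 0 ≤ (1 - tau p01 p11 ω3) * (p11 - p01) * (1 - ω2) * (ω4 - x) :=
    mul_nonneg (mul_nonneg (mul_nonneg hs hd) (sub_nonneg.2 h2')) (sub_nonneg.2 h4x)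
  have hbad := mul_nonneg (sub_nonneg.2 h1') (add_nonneg (sub_nonneg.2 hgain) hrest)
  have hgood : 0 ≤ ω1 * ((1 - p11) * (p11 - p01) * (1 - ω2) * (ω3 - x)) :=
    mul_nonneg h1 (mul_nonneg (mul_nonneg (mul_nonneg hq hd) (sub_nonneg.2 h2'))
      (sub_nonneg.2 (h4x.trans h34)))
  unfold tau at *
  linarith
end

section
/- Fix real numbers p01, p11 with 0 ≤ p01 ≤ p11 ≤ 1 and real numbers ω1, ω2, ω3, x, y ∈ [0,1] with ω1 ≥ ω2 ≥ ω3 ≥ x ≥ y (here x and y play the roles of the beliefs ω_i, ω_j of two channels i, j with {i,j} ∩ {1,2} = ∅). Then R̄1(y) ≥ R̄2(x,y), where R̄1(y) = [1 − (1−ω1)(1−y)] + ω1·y·[1 − (1−p11)²] + ω1(1−y)[1 − (1−p11)(1−τ(ω2))] + (1−ω1)·y·[1 − (1−p11)(1−τ(ω2))] + (1−ω1)(1−y)[1 − (1−τ(ω2))(1−τ(ω3))], and R̄2(x,y) = [1 − (1−x)(1−y)] + x·y·[1 − (1−p11)²] + x(1−y)[1 − (1−p11)(1−τ(ω1))] +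 (1−x)·y·[1 − (1−p11)(1−τ(ω1))] + (1−x)(1−y)[1 − (1−τ(ω1))(1−τ(ω2))]. -/
/-- When `p11 ≥ p01`, sensing two channels of beliefs `x,y` both outside `{1,2}`
is dominated by sensing channel `1` together with the channel of belief `y`:
`R̄2(x,y) ≤ R̄1(y)`. -/
theorem Rbar2_le_Rbar1 (p01 p11 ω1 ω2 ω3 x y : ℝ)
    (hp0 : 0 ≤ p01) (hp1 : p01 ≤ p11) (hp2 : p11 ≤ 1)
    (h1 : 0 ≤ ω1) (h1' : ω1 ≤ 1) (h2 : 0 ≤ ω2) (h2' : ω2 ≤ 1)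
    (h3 : 0 ≤ ω3) (h3' : ω3 ≤ 1)
    (hx : 0 ≤ x) (hx' : x ≤ 1) (hy : 0 ≤ y) (hy' : y ≤ 1)
    (h12 : ω2 ≤ ω1) (h23 : ω3 ≤ ω2) (h3x : x ≤ ω3) (hxy : y ≤ x) :
    ((1 - (1 - x) * (1 - y))
      + x * y * (1 - (1 - p11) * (1 - p11))
      + x * (1 - y) * (1 - (1 - p11) * (1 - tau p01 p11 ω1))
      + (1 - x) * y * (1 - (1 - p11) * (1 - tau p01 p11 ω1))
      + (1 - x) * (1 - y) * (1 - (1 - tau p01 p11 ω1) * (1 - tau p01 p11 ω2)))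
    ≤
    ((1 - (1 - ω1) * (1 - y))
      + ω1 * y * (1 - (1 - p11) * (1 - p11))
      + ω1 * (1 - y) * (1 - (1 - p11) * (1 - tau p01 p11 ω2))
      + (1 - ω1) * y * (1 - (1 - p11) * (1 - tau p01 p11 ω2))
      + (1 - ω1) * (1 - y) * (1 - (1 - tau p01 p11 ω2) * (1 - tau p01 p11 ω3))) := by
  have hq : 0 ≤ 1 - p11 := by linarith
  have hd : 0 ≤ p11 - p01 := by linarith
  have hu : 0 ≤ 1 - x := by linarith
  have hv : 0 ≤ 1 - y := by linarith
  have ha : 0 ≤ 1 - ω1 := by linarith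
  have hb : 0 ≤ 1 - ω2 := by linarith
  have hqd : 0 ≤ (1 - p11) * (p11 - p01) := mul_nonneg hq hd
  have hqd_le : 2 * ((1 - p11) * (p11 - p01)) ≤ 1 := by
    nlinarith [sq_nonneg ((1 - p11) - (p11 - p01))]
  have hm : 0 ≤ x * (1 - y) + (1 - x) * y := by positivity
  have hm_le : x * (1 - y) + (1 - x) * y ≤ 2 * (1 - y) := by
    nlinarith [mul_nonneg hu hv, mul_nonneg hv hv]
  have hgain : 0 ≤ (1 - y) - (1 - p11) * (p11 - p01) * (x * (1 - y) + (1 - x) * y) := by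
    nlinarith [mul_le_mul_of_nonneg_left hm_le hqd, mul_le_mul_of_nonneg_right hqd_le hv]
  have hB : 0 ≤ 1 - tau p01 p11 ω2 := by
    unfold tau
    nlinarith [mul_nonneg hd hb]
  have t1 : 0 ≤ (ω1 - x) * (y * ((1 - p11) * (p11 - p01)) * (1 - ω2)) :=
    mul_nonneg (by linarith) (by positivity)
  have t2 := mul_nonneg (show 0 ≤ ω1 - x by linarith) hgain
  have t3 := mul_nonneg (mul_nonneg hqd (show 0 ≤ ω2 - x by linarith)) hm
  have t4 : 0 ≤ (1 - tau p01 p11 ω2) * (1 - y) * (p11 - p01) * (1 - ω1) * (ω3 - x) :=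
    mul_nonneg (by positivity) (by linarith)
  unfold tau at t4 ⊢
  linarith
end

section
/- Fix real numbers p01, p11 with 0 ≤ p01 ≤ p11 ≤ 1 and real numbers ω1, ω2, ω3, ω4, x, y ∈ [0,1] with ω1 ≥ ω2 ≥ ω3 ≥ ω4 ≥ x ≥ y. Then R* ≥ R̄2(x,y), where R* = [1 − (1−ω1)(1−ω2)] + ω1ω2[1 − (1−p11)²] + ω1(1−ω2)[1 − (1−p11)(1−τ(ω3))] + (1−ω1)ω2[1 − (1−p11)(1−τ(ω3))] + (1−ω1)(1−ω2)[1 − (1−τ(ω3))(1−τ(ω4))], and R̄2(x,y) = [1 − (1−x)(1−y)] + x·y·[1 − (1−p11)²] + x(1−y)[1 − (1−p11)(1−τ(ω1))] + (1−x)·y·[1 − (1−p11)(1−τ(ω1))] + (1−x)(1−y)[1 − (1−τ(ω1))(1−τ(ω2))]. That is, when p11 ≥ p01, sensing in the first slot two channels both outside the top two beliefs cannot outperform the myopic choice {1,2}. -/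
/-- Polynomial inequality in the complements `a ≤ b ≤ c ≤ d ≤ X, Y` of the beliefs. -/
lemma complement_bound_nonneg {a b c d X Y : ℝ} (ha : 0 ≤ a) (hab : a ≤ b) (hbc : b ≤ c)
    (hcd : c ≤ d) (hdX : d ≤ X) (hdY : d ≤ Y) (hb : b ≤ 1) :
    0 ≤ X * Y - a * b + ((X + Y) * a + X * Y * (b - a) - (a + b) * c - a * b * (d - c)) := by
  have hXY : c * c ≤ X * Y := mul_le_mul (hcd.trans hdX) (hcd.trans hdY)
    (by linarith) (by linarith)
  have h₁ : 0 ≤ (X * Y - c * c) * (1 + (b - a)) := mul_nonneg (by linarith) (by linarith)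
  have h₂ : 0 ≤ (X + Y - 2 * d) * a := mul_nonneg (by linarith) ha
  have h₃ : 0 ≤ (c - b) * (c + a) := mul_nonneg (by linarith) (by linarith)
  have h₄ : 0 ≤ c * c * (b - a) := mul_nonneg (mul_self_nonneg c) (by linarith)
  have h₅ : 0 ≤ a * (2 - b) * (d - c) :=
    mul_nonneg (mul_nonneg ha (by linarith)) (by linarith)
  linarith

/-- When `p11 ≥ p01`, sensing in the first slot two channels (beliefs `x,y`)
both outside the top two cannot outperform the myopic choice `{1,2}`:
`R̄2(x,y) ≤ R*`. -/
theorem Rbar2_le_Rstar (p01 p11 ω1 ω2 ω3 ω4 x y : ℝ)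
    (hp0 : 0 ≤ p01) (hp1 : p01 ≤ p11) (hp2 : p11 ≤ 1)
    (h1 : 0 ≤ ω1) (h1' : ω1 ≤ 1) (h2 : 0 ≤ ω2) (h2' : ω2 ≤ 1)
    (h3 : 0 ≤ ω3) (h3' : ω3 ≤ 1) (h4 : 0 ≤ ω4) (h4' : ω4 ≤ 1)
    (hx : 0 ≤ x) (hx' : x ≤ 1) (hy : 0 ≤ y) (hy' : y ≤ 1)
    (h12 : ω2 ≤ ω1) (h23 : ω3 ≤ ω2) (h34 : ω4 ≤ ω3) (h4x : x ≤ ω4) (hxy : y ≤ x) :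
    ((1 - (1 - x) * (1 - y))
      + x * y * (1 - (1 - p11) * (1 - p11))
      + x * (1 - y) * (1 - (1 - p11) * (1 - tau p01 p11 ω1))
      + (1 - x) * y * (1 - (1 - p11) * (1 - tau p01 p11 ω1))
      + (1 - x) * (1 - y) * (1 - (1 - tau p01 p11 ω1) * (1 - tau p01 p11 ω2)))
    ≤
    ((1 - (1 - ω1) * (1 - ω2))
      + ω1 * ω2 * (1 - (1 - p11) * (1 - p11))
      + ω1 * (1 - ω2) * (1 - (1 - p11) * (1 - tau p01 p11 ω3))
      + (1 - ω1) * ω2 * (1 - (1 - p11) * (1 - tau p01 p11 ω3))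
      + (1 - ω1) * (1 - ω2) * (1 - (1 - tau p01 p11 ω3) * (1 - tau p01 p11 ω4))) := by
  have hF := complement_bound_nonneg (a := 1 - ω1) (b := 1 - ω2) (c := 1 - ω3) (d := 1 - ω4)
    (X := 1 - x) (Y := 1 - y) (by linarith) (by linarith) (by linarith) (by linarith)
    (by linarith) (by linarith) (by linarith)
  have hab : 0 ≤ (1 - ω1) * (1 - ω2) := mul_nonneg (by linarith) (by linarith)
  have hXY : (1 - ω1) * (1 - ω2) ≤ (1 - x) * (1 - y) :=
    mul_le_mul (by linarith) (by linarith) (by linarith) (by linarith)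
  have hcd : (1 - ω3) * (1 - ω4) ≤ (1 - x) * (1 - y) :=
    mul_le_mul (by linarith) (by linarith) (by linarith) (by linarith)
  have hq : 0 ≤ (1 - p11) * (p11 - p01) := mul_nonneg (by linarith) (by linarith)
  have hq' : (1 - p11) * (p11 - p01) ≤ 1 :=
    mul_le_one₀ (by linarith) (by linarith) (by linarith)
  have h₁ := mul_nonneg hq hF
  have h₂ := mul_nonneg (sub_nonneg.2 hq') (sub_nonneg.2 hXY)
  have h₃ := mul_nonneg (sq_nonneg (p11 - p01)) (mul_nonneg hab (sub_nonneg.2 hcd))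
  unfold tau
  linarith
end
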